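/- arXiv:1707.03810 — 2 statements merged into one kernel-verified Lean document; each statement's English description precedes it below -/
import Mathlib

section
/- Let b be a real number with b ∉ ℤ, let Q = {(x,y) ∈ ℝ × ℤ : x + y ≥ b, x ≥ 0}, and set r = b − ⌊b⌋. Then the convex hull of Q (viewed as a subset of ℝ²) equals the polyhedron {(x,y) ∈ ℝ² : x ≥ 0, x + y ≥ b, x + r·y ≥ r·⌈b⌉}. -/
/-- A point on a segment joining two consecutive integer levels, translated to the right by a
nonnegative amount, lies in the convex hull of the mixed-integer set. -/
theorem mem_convexHull_of_interpolation_le {b x y u v : ℝ} {k : ℤ}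
    (hky : (k : ℝ) ≤ y) (hyk : y ≤ k + 1) (hu : 0 ≤ u) (hv : 0 ≤ v)
    (hub : b ≤ u + k) (hvb : b ≤ v + (k + 1))
    (h : (k + 1 - y) * u + (y - k) * v ≤ x) :
    (x, y) ∈ convexHull ℝ
      {p : ℝ × ℝ | (∃ y : ℤ, p.2 = (y : ℝ)) ∧ p.1 + p.2 ≥ b ∧ p.1 ≥ 0} := by
  set s := x - ((k + 1 - y) * u + (y - k) * v) with hs
  have hs0 : 0 ≤ s := sub_nonneg.mpr h
  have hmem := (convex_convexHull ℝ
      {p : ℝ × ℝ | (∃ y : ℤ, p.2 = (y : ℝ)) ∧ p.1 + p.2 ≥ b ∧ p.1 ≥ 0})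
    (subset_convexHull ℝ _ (show (u + s, (k : ℝ)) ∈ _ from
      ⟨⟨k, rfl⟩, by dsimp only; linarith, by dsimp only; linarith⟩))
    (subset_convexHull ℝ _ (show (v + s, (k : ℝ) + 1) ∈ _ from
      ⟨⟨k + 1, by push_cast; rfl⟩, by dsimp only; linarith, by dsimp only; linarith⟩))
    (show 0 ≤ k + 1 - y by linarith) (show 0 ≤ y - k by linarith) (by ring)
  convert hmem using 1
  ext
  · simp only [Prod.smul_mk, Prod.mk_add_mk, smul_eq_mul, hs]
    ring
  · simp only [Prod.smul_mk, Prod.mk_add_mk, smul_eq_mul]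
    ring


/-- For `b ∉ ℤ`, the convex hull of the two-variable mixed-integer set
`Q = {(x,y) ∈ ℝ × ℤ : x + y ≥ b, x ≥ 0}` is described by the constraints
`x ≥ 0`, `x + y ≥ b` and the basic mixed-integer rounding inequality
`x + r·y ≥ r·⌈b⌉`, where `r = b - ⌊b⌋`. -/
theorem basic_mir_convex_hull (b : ℝ) (hb : ∀ z : ℤ, (z : ℝ) ≠ b) :
    convexHull ℝ {p : ℝ × ℝ | (∃ y : ℤ, p.2 = (y : ℝ)) ∧ p.1 + p.2 ≥ b ∧ p.1 ≥ 0} =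
      {p : ℝ × ℝ | p.1 ≥ 0 ∧ p.1 + p.2 ≥ b ∧
        p.1 + (b - (⌊b⌋ : ℝ)) * p.2 ≥ (b - (⌊b⌋ : ℝ)) * (⌈b⌉ : ℝ)} := by
  have hceil : (⌈b⌉ : ℝ) = ⌊b⌋ + 1 := by
    have : ⌈b⌉ = ⌊b⌋ + 1 := by
      rw [Int.ceil_eq_iff]
      push_cast
      exact ⟨by linarith [lt_of_le_of_ne (Int.floor_le b) (hb ⌊b⌋)], (Int.lt_floor_add_one b).le⟩
    exact_mod_cast this
  rw [hceil]
  have hn := Int.floor_le b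
  have hn1 := Int.lt_floor_add_one b
  generalize ⌊b⌋ = n at hn hn1
  apply Set.Subset.antisymm
  · apply convexHull_min
    · rintro ⟨x, _⟩ ⟨⟨k, rfl⟩, hxb, hx⟩
      dsimp only at hxb hx
      refine ⟨hx, hxb, ?_⟩
      dsimp only
      rcases le_or_gt k n with hk | hk
      · have hk' : (k : ℝ) ≤ n := by exact_mod_cast hk
        nlinarith
      · have hk' : (n : ℝ) + 1 ≤ k := by exact_mod_cast hk
        nlinarith
    · rintro ⟨x, y⟩ ⟨h1, h2, h3⟩ ⟨x', y'⟩ ⟨h1', h2', h3'⟩ s t hs ht hst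
      simp only [ge_iff_le, Set.mem_ofPred_eq, Prod.smul_mk, Prod.mk_add_mk, smul_eq_mul] at *
      obtain rfl : t = 1 - s := by linarith
      refine ⟨by positivity, ?_, ?_⟩
      · linarith [mul_le_mul_of_nonneg_left h2 hs, mul_le_mul_of_nonneg_left h2' ht]
      · linarith [mul_le_mul_of_nonneg_left h3 hs, mul_le_mul_of_nonneg_left h3' ht]
  · rintro ⟨x, y⟩ ⟨hx, hxb, hxr⟩
    dsimp only at hx hxb hxr
    have hky := Int.floor_le y
    have hyk := (Int.lt_floor_add_one y).le
    generalize ⌊y⌋ = k at hky hyk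
    rcases lt_trichotomy k n with hk | rfl | hk
    · have hk' : (k : ℝ) + 1 ≤ n := by exact_mod_cast hk
      exact mem_convexHull_of_interpolation_le (u := b - k) (v := b - (k + 1)) hky hyk
        (by linarith) (by linarith) (by linarith) (by linarith) (by linarith)
    · exact mem_convexHull_of_interpolation_le (u := b - k) (v := 0) hky hyk
        (by linarith) le_rfl (by linarith) (by linarith) (by linarith)
    · have hk' : (n : ℝ) + 1 ≤ k := by exact_mod_cast hk
      exact mem_convexHull_of_interpolation_le (u := 0) (v := 0) hky hyk
        le_rfl le_rfl (by linarith) (by linarith) (by linarith)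
end

section
/- Let K be a finite index set, a : K → ℝ with aᵢ > 0 for all i ∈ K, a₀ ∈ ℝ, and define the unsplittable-flow arc set F_U = {(x,y) ∈ {0,1}^K × ℤ : ∑_{i∈K} aᵢ xᵢ ≤ a₀ + y} and its fractional counterpart F_U^r = {(x,y) ∈ {0,1}^K × ℤ : ∑_{i∈K} rᵢ xᵢ ≤ r₀ + y}, where rᵢ = aᵢ − ⌊aᵢ⌋ for all i ∈ K and r₀ = a₀ − ⌊a₀⌋. Then for any π ∈ ℝ^K and π₀ ∈ ℝ, the inequality ∑_{i∈K} πᵢ xᵢ ≤ π₀ + y is valid for F_U (holds for all its points) if and only if the inequality ∑_{i∈K} (πᵢ − ⌊aᵢ⌋) xᵢ ≤ π₀ − ⌊a₀⌋ + y is valid for F_U^r. -/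
open Finset

/-- A sum of integer multiples of `0`/`1`-valued reals is an integer. -/
theorem exists_int_cast_eq_sum_mul_of_zero_or_one {K : Type*} [Fintype K] (c : K → ℤ) {x : K → ℝ}
    (hx : ∀ i, x i = 0 ∨ x i = 1) : ∃ n : ℤ, (n : ℝ) = ∑ i, (c i : ℝ) * x i := by
  have hz : ∀ i, ∃ z : ℤ, (z : ℝ) = x i := fun i =>
    (hx i).elim (fun h => ⟨0, by simp [h]⟩) (fun h => ⟨1, by simp [h]⟩)
  choose z hz using hz
  exact ⟨∑ i, c i * z i, by simp [hz]⟩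

/-- Atamtürk–Rajan correspondence between the unsplittable-flow arc set `F_U` and its
fractional counterpart `F_U^r`: the inequality `∑ᵢ πᵢxᵢ ≤ π₀ + y` is valid for
`F_U = {(x,y) ∈ {0,1}^K × ℤ : ∑ᵢ aᵢxᵢ ≤ a₀ + y}` iff
`∑ᵢ (πᵢ - ⌊aᵢ⌋)xᵢ ≤ π₀ - ⌊a₀⌋ + y` is valid for
`F_U^r = {(x,y) ∈ {0,1}^K × ℤ : ∑ᵢ rᵢxᵢ ≤ r₀ + y}` with `rᵢ = aᵢ - ⌊aᵢ⌋`, `r₀ = a₀ - ⌊a₀⌋`. -/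
theorem unsplittable_fractional_validity_correspondence
    (K : Type*) [Fintype K] (a : K → ℝ) (ha : ∀ i, 0 < a i) (a0 : ℝ)
    (π : K → ℝ) (π0 : ℝ) :
    (∀ (x : K → ℝ) (y : ℤ), (∀ i, x i = 0 ∨ x i = 1) →
        (∑ i, a i * x i ≤ a0 + (y : ℝ)) →
        ∑ i, π i * x i ≤ π0 + (y : ℝ)) ↔
    (∀ (x : K → ℝ) (y : ℤ), (∀ i, x i = 0 ∨ x i = 1) →
        (∑ i, (a i - (⌊a i⌋ : ℝ)) * x i ≤ (a0 - (⌊a0⌋ : ℝ)) + (y : ℝ)) →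
        ∑ i, (π i - (⌊a i⌋ : ℝ)) * x i ≤ (π0 - (⌊a0⌋ : ℝ)) + (y : ℝ)) := by
  simp only [sub_mul, Finset.sum_sub_distrib]
  constructor
  · intro h x y hx hy
    obtain ⟨n, hn⟩ := exists_int_cast_eq_sum_mul_of_zero_or_one (fun i => ⌊a i⌋) hx
    have key := h x (y - ⌊a0⌋ + n) hx (by push_cast; linarith)
    push_cast at key
    linarith
  · intro h x y hx hy
    obtain ⟨n, hn⟩ := exists_int_cast_eq_sum_mul_of_zero_or_one (fun i => ⌊a i⌋) hx
    have key := h x (y + ⌊a0⌋ - n) hx (by push_cast; linarith)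
    push_cast at key
    linarith
end
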